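/- Let λ ∈ ℂ be not a rational number. If F ∈ K = ℂ(x,y) satisfies x·(∂x F) + λ·y·(∂y F) = 0, then F is constant, i.e. F lies in the image of ℂ in K. (Equivalently: the closed 1-form dy/y − λ dx/x, defining a linear non-resonant singularity, admits no nonconstant rational first integral.) -/

import Mathlib

open MvPolynomial

noncomputable section

/-- The field of rational functions `ℂ(x,y)`. -/
abbrev RatF : Type := FractionRing (MvPolynomial (Fin 2) ℂ)

/-- Wedge product of two rational 1-forms: `ω ∧ θ = ω₁ θ₂ - ω₂ θ₁`. -/
def wedge (ω θ : RatF × RatF) : RatF := ω.1 * θ.2 - ω.2 * θ.1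

/-- Exterior derivative of a rational 1-form: `dω = ∂x ω₂ - ∂y ω₁`. -/
def extd (dx dy : Derivation ℂ RatF RatF) (ω : RatF × RatF) : RatF := dx ω.2 - dy ω.1

/-- Differential of a rational function: `dF = (∂x F, ∂y F)`. -/
def d0 (dx dy : Derivation ℂ RatF RatF) (F : RatF) : RatF × RatF := (dx F, dy F)

/-- The derivations `dx`, `dy` extend the partial derivatives on `ℂ[x,y]`. -/
def ExtendsPartials (dx dy : Derivation ℂ RatF RatF) : Prop :=
  (∀ p : MvPolynomial (Fin 2) ℂ,
      dx (algebraMap (MvPolynomial (Fin 2) ℂ) RatF p)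
        = algebraMap (MvPolynomial (Fin 2) ℂ) RatF (pderiv 0 p)) ∧
  (∀ p : MvPolynomial (Fin 2) ℂ,
      dy (algebraMap (MvPolynomial (Fin 2) ℂ) RatF p)
        = algebraMap (MvPolynomial (Fin 2) ℂ) RatF (pderiv 1 p))

/-- `(Ω, η, ξ)` is a projective triple: (Proj.1) `dΩ = η∧Ω`, (Proj.2) `dη = Ω∧ξ`,
(Proj.3) `dξ = ξ∧η`. -/
def IsProjTriple (dx dy : Derivation ℂ RatF RatF) (Ω η ξ : RatF × RatF) : Prop :=
  extd dx dy Ω = wedge η Ω ∧ extd dx dy η = wedge Ω ξ ∧ extd dx dy ξ = wedge ξ η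

/-- The image of the variable `x` in `K = ℂ(x,y)`. -/
def xK : RatF := algebraMap (MvPolynomial (Fin 2) ℂ) RatF (X 0)

/-- The image of the variable `y` in `K = ℂ(x,y)`. -/
def yK : RatF := algebraMap (MvPolynomial (Fin 2) ℂ) RatF (X 1)

theorem MvPolynomial.coeff_X_mul_pderiv {σ R : Type*} [CommSemiring R] (i : σ)
    (p : MvPolynomial σ R) (m : σ →₀ ℕ) :
    coeff m (X i * pderiv i p) = (m i : R) * coeff m p := by
  classical
  induction p using MvPolynomial.induction_on' with
  | monomial n a =>
    rw [X_mul_pderiv_monomial, coeff_smul, coeff_monomial, nsmul_eq_mul]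
    split_ifs with h
    · rw [h]
    · simp
  | add p q hp hq => rw [map_add, mul_add, coeff_add, coeff_add, hp, hq, mul_add]

/-- The polynomial vector field `x ∂x + lam y ∂y`. -/
def linearField (lam : ℂ) (p : MvPolynomial (Fin 2) ℂ) : MvPolynomial (Fin 2) ℂ :=
  X 0 * pderiv 0 p + C lam * (X 1 * pderiv 1 p)

theorem coeff_linearField (lam : ℂ) (p : MvPolynomial (Fin 2) ℂ) (m : Fin 2 →₀ ℕ) :
    coeff m (linearField lam p) = ((m 0 : ℂ) + lam * m 1) * coeff m p := by
  rw [linearField, coeff_add, coeff_C_mul, coeff_X_mul_pderiv, coeff_X_mul_pderiv]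
  ring

/-- The eigenvalues of `x ∂x + lam y ∂y` on distinct monomials are distinct. -/
theorem eq_of_weight_eq {lam : ℂ} (hlam : ∀ q : ℚ, lam ≠ (q : ℂ)) {m n : Fin 2 →₀ ℕ}
    (h : (m 0 : ℂ) + lam * m 1 = n 0 + lam * n 1) : m = n := by
  have h1 : m 1 = n 1 := by
    by_contra hne
    have hne' : (m 1 : ℂ) - n 1 ≠ 0 := sub_ne_zero.2 (by exact_mod_cast hne)
    refine hlam (((n 0 : ℚ) - m 0) / ((m 1 : ℚ) - n 1)) ?_
    push_cast
    rw [eq_div_iff hne']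
    linear_combination h
  have h0 : m 0 = n 0 := by
    rw [h1] at h
    exact_mod_cast add_right_cancel h
  ext i
  fin_cases i
  · exact h0
  · exact h1

/-- A polynomial dividing its image under `x ∂x + lam y ∂y` is an eigenvector. -/
theorem exists_linearField_eq_C_mul {lam : ℂ} {q : MvPolynomial (Fin 2) ℂ} (hq : q ≠ 0)
    (h : q ∣ linearField lam q) : ∃ c : ℂ, linearField lam q = C c * q := by
  obtain ⟨r, hr⟩ := h
  rcases eq_or_ne r 0 with rfl | hr0
  · exact ⟨0, by simp [hr]⟩
  have hle : (linearField lam q).totalDegree ≤ q.totalDegree := by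
    refine Finset.sup_mono fun m hm => ?_
    rw [mem_support_iff, coeff_linearField] at hm
    exact mem_support_iff.2 (right_ne_zero_of_mul hm)
  rw [hr, totalDegree_mul_of_isDomain hq hr0] at hle
  refine ⟨coeff 0 r, ?_⟩
  rw [← totalDegree_eq_zero_iff_eq_C.1 (by omega : r.totalDegree = 0), hr, mul_comm]

/-- For `λ ∉ ℚ`, any rational solution of `x ∂x F + λ y ∂y F = 0` is constant:
the linear non-resonant singularity has no nonconstant rational first integral. -/
theorem nonresonant_no_firstIntegral (dx dy : Derivation ℂ RatF RatF)
    (hext : ExtendsPartials dx dy) (lam : ℂ) (hlam : ∀ q : ℚ, lam ≠ (q : ℂ))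
    (F : RatF) (hF : xK * dx F + algebraMap ℂ RatF lam * (yK * dy F) = 0) :
    F ∈ Set.range (algebraMap ℂ RatF) := by
  obtain ⟨p, q, hpq, hF'⟩ :=
    IsFractionRing.exists_reduced_fraction (A := MvPolynomial (Fin 2) ℂ) F
  have hq : (q : MvPolynomial (Fin 2) ℂ) ≠ 0 := nonZeroDivisors.coe_ne_zero q
  obtain ⟨q, hq'⟩ := q
  dsimp only at hpq hq
  have hinj : Function.Injective (algebraMap (MvPolynomial (Fin 2) ℂ) RatF) :=
    IsFractionRing.injective _ _
  have hqK : algebraMap (MvPolynomial (Fin 2) ℂ) RatF q ≠ 0 :=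
    (map_ne_zero_iff _ hinj).2 hq
  have hmul : F * algebraMap (MvPolynomial (Fin 2) ℂ) RatF q
      = algebraMap (MvPolynomial (Fin 2) ℂ) RatF p := by
    rw [← hF']
    exact IsLocalization.mk'_spec RatF p ⟨q, hq'⟩
  have hC : ∀ c : ℂ, algebraMap ℂ RatF c
      = algebraMap (MvPolynomial (Fin 2) ℂ) RatF (C c) := fun c => rfl
  have hx := congrArg dx hmul
  have hy := congrArg dy hmul
  rw [Derivation.leibniz, hext.1, hext.1, smul_eq_mul, smul_eq_mul] at hx
  rw [Derivation.leibniz, hext.2, hext.2, smul_eq_mul, smul_eq_mul] at hy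
  have hwronsk : p * linearField lam q = q * linearField lam p := by
    apply hinj
    simp only [linearField, map_mul, map_add, ← hC]
    rw [← hx, ← hy, ← hmul]
    change _ * (xK * _ + _ * (yK * _)) = _ * (xK * _ + _ * (yK * _))
    linear_combination (-(algebraMap (MvPolynomial (Fin 2) ℂ) RatF q) ^ 2) * hF
  obtain ⟨c, hc⟩ := exists_linearField_eq_C_mul hq
    (hpq.symm.dvd_of_dvd_mul_left ⟨linearField lam p, hwronsk⟩)
  have hcp : linearField lam p = C c * p := by
    apply mul_left_cancel₀ hq
    rw [← hwronsk, hc]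
    ring
  have hweight : ∀ r : MvPolynomial (Fin 2) ℂ, linearField lam r = C c * r →
      ∀ m, coeff m r ≠ 0 → (m 0 : ℂ) + lam * m 1 = c := fun r hr m hm => by
    have h := congrArg (coeff m) hr
    rw [coeff_linearField, coeff_C_mul] at h
    exact mul_right_cancel₀ hm h
  obtain ⟨m, hm⟩ := ne_zero_iff.1 hq
  have hzero : ∀ r : MvPolynomial (Fin 2) ℂ, linearField lam r = C c * r →
      ∀ n, n ≠ m → coeff n r = 0 := fun r hr n hn => by
    by_contra h
    exact hn (eq_of_weight_eq hlam ((hweight r hr n h).trans (hweight q hc m hm).symm))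
  refine ⟨coeff m p / coeff m q, ?_⟩
  apply mul_right_cancel₀ hqK
  rw [hmul, hC, ← map_mul]
  congr 1
  ext n
  rw [coeff_C_mul]
  rcases eq_or_ne n m with rfl | hn
  · exact div_mul_cancel₀ _ hm
  · rw [hzero q hc n hn, hzero p hcp n hn, mul_zero]
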